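/- Let B and R be disjoint finite sets of points in the plane with |B| ≥ 2, and let d be the minimum distance between two distinct points of B. If R ε-densely covers B for some ε with 0 < ε < π, then no point of B lies on the boundary of the convex hull of B ∪ R; that is, every point of B lies in the topological interior of the convex hull of B ∪ R. -/

import Mathlib

open scoped RealInnerProductSpace ENNReal Classical

noncomputable section

/-- Points of the Euclidean plane. -/
abbrev Pt : Type := EuclideanSpace ℝ (Fin 2)

/-- The planar determinant `det (u, v)` of two vectors. -/
def det2 (u v : Pt) : ℝ := u 0 * v 1 - u 1 * v 0

/-- No three of the points of `S` are collinear. -/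
def NoThreeCollinear (S : Set Pt) : Prop :=
  ∀ p ∈ S, ∀ q ∈ S, ∀ r ∈ S, p ≠ q → p ≠ r → q ≠ r → det2 (q - p) (r - p) ≠ 0

/-- `S` is in strong general position: no three points are collinear and for any four
distinct points `p₁ p₂ p₃ p₄` the line through `p₁,p₂` is not parallel to the line
through `p₃,p₄`. -/
def StrongGenPos (S : Set Pt) : Prop :=
  NoThreeCollinear S ∧
    ∀ p₁ ∈ S, ∀ p₂ ∈ S, ∀ p₃ ∈ S, ∀ p₄ ∈ S,
      p₁ ≠ p₂ → p₁ ≠ p₃ → p₁ ≠ p₄ → p₂ ≠ p₃ → p₂ ≠ p₄ → p₃ ≠ p₄ →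
        det2 (p₂ - p₁) (p₄ - p₃) ≠ 0

/-- A simple polygon, given by a cyclic sequence of `n ≥ 3` distinct vertices
(encoded as an `n`-periodic function `ℕ → Pt`), such that no point of the plane lies on
more than two closed edges, and the only points lying on exactly two edges are vertices. -/
structure SimplePolygon where
  n : ℕ
  three_le : 3 ≤ n
  vtx : ℕ → Pt
  periodic : ∀ i, vtx (i + n) = vtx i
  inj : ∀ i < n, ∀ j < n, vtx i = vtx j → i = j
  simple : ∀ x : Pt, {i | i < n ∧ x ∈ segment ℝ (vtx i) (vtx (i + 1))}.ncard ≤ 2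
  vtx_of_two : ∀ x : Pt,
    {i | i < n ∧ x ∈ segment ℝ (vtx i) (vtx (i + 1))}.ncard = 2 → ∃ i < n, x = vtx i

namespace SimplePolygon

/-- The boundary of a simple polygon: the union of its closed edges. -/
def boundary (P : SimplePolygon) : Set Pt :=
  ⋃ i ∈ Finset.range P.n, segment ℝ (P.vtx i) (P.vtx (i + 1))

/-- The interior of a simple polygon: the union of the bounded connected components of the
complement of the boundary. -/
def interior (P : SimplePolygon) : Set Pt :=
  {x | x ∉ P.boundary ∧ Bornology.IsBounded (connectedComponentIn P.boundaryᶜ x)}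

/-- A simple polygon, regarded as a point set: boundary together with interior. -/
def region (P : SimplePolygon) : Set Pt := P.boundary ∪ P.interior

/-- The set of vertices of the polygon. -/
def vertexSet (P : SimplePolygon) : Set Pt := {x | ∃ i < P.n, x = P.vtx i}

/-- Twice the shoelace signed area. -/
def shoelace (P : SimplePolygon) : ℝ := ∑ i ∈ Finset.range P.n, det2 (P.vtx i) (P.vtx (i + 1))

/-- The vertices are listed in counterclockwise order (positive shoelace signed area). -/
def CCW (P : SimplePolygon) : Prop := 0 < P.shoelace

/-- The vertex `vtx (i+1)` is a convex vertex:
`det (v_{i+1} − v_i, v_{i+2} − v_{i+1}) > 0` (vertices listed counterclockwise). -/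
def ConvexAt (P : SimplePolygon) (i : ℕ) : Prop :=
  0 < det2 (P.vtx (i + 1) - P.vtx i) (P.vtx (i + 2) - P.vtx (i + 1))

/-- The number of convex vertices of the polygon. -/
def numConvex (P : SimplePolygon) : ℕ := {i | i < P.n ∧ P.ConvexAt i}.ncard

/-- Continuous paths from `s` to `t` staying inside the polygon. -/
def pathsIn (P : SimplePolygon) (s t : Pt) : Set (ℝ → Pt) :=
  {γ | ContinuousOn γ (Set.Icc 0 1) ∧ γ 0 = s ∧ γ 1 = t ∧ γ '' Set.Icc (0 : ℝ) 1 ⊆ P.region}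

/-- The geodesic distance between `s` and `t` inside the polygon: the infimum of the
lengths (total variations) of continuous paths in the polygon from `s` to `t`. -/
def geodDist (P : SimplePolygon) (s t : Pt) : ℝ≥0∞ :=
  ⨅ γ ∈ P.pathsIn s t, eVariationOn γ (Set.Icc 0 1)

end SimplePolygon

/-- Length of a polygonal path through a list of points. -/
def polylineLen : List Pt → ℝ
  | [] => 0
  | [_] => 0
  | a :: b :: l => dist a b + polylineLen (b :: l)

/-- The polygonal path through a list of points, as a point set. -/
def polylineSet : List Pt → Set Pt
  | [] => ∅
  | [a] => {a}
  | a :: b :: l => segment ℝ a b ∪ polylineSet (b :: l)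

/-- `L` is the vertex sequence of the geodesic from `s` to `t` inside the polygon `P`:
a polygonal path inside `P` from `s` to `t`, with consecutive vertices distinct, with no
three consecutive vertices collinear, whose length realizes the geodesic distance. -/
def SimplePolygon.IsGeodesicChain (P : SimplePolygon) (s t : Pt) (L : List Pt) : Prop :=
  L.head? = some s ∧ L.getLast? = some t ∧ List.Chain' (· ≠ ·) L ∧
  (∀ i, i + 2 < L.length →
      det2 (L.getD (i + 1) 0 - L.getD i 0) (L.getD (i + 2) 0 - L.getD i 0) ≠ 0) ∧
  polylineSet L ⊆ P.region ∧
  ENNReal.ofReal (polylineLen L) = P.geodDist s t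

/-- The triple `(p,q,r)` is in geodesic counterclockwise order with respect to `P`:
writing the geodesics `π(p,q) = ⟨p = v₀, …, v_k = q⟩` and `π(p,r) = ⟨p = u₀, …, u_{k'} = r⟩`
and taking the smallest index `i > 0` with `v_i ≠ u_i`, we have
`det (v_i − v_{i−1}, u_i − v_{i−1}) > 0`. -/
def geodesicCCW (P : SimplePolygon) (p q r : Pt) : Prop :=
  ∃ L M : List Pt, P.IsGeodesicChain p q L ∧ P.IsGeodesicChain p r M ∧
    ∃ i : ℕ, 0 < i ∧ (∀ j < i, L[j]? = M[j]?) ∧ L[i]? ≠ M[i]? ∧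
      ∃ a b c : Pt, L[i - 1]? = some a ∧ L[i]? = some b ∧ M[i]? = some c ∧
        0 < det2 (b - a) (c - a)

/-- The triple `(p,q,r)` is in geodesic clockwise order with respect to `P`. -/
def geodesicCW (P : SimplePolygon) (p q r : Pt) : Prop :=
  ∃ L M : List Pt, P.IsGeodesicChain p q L ∧ P.IsGeodesicChain p r M ∧
    ∃ i : ℕ, 0 < i ∧ (∀ j < i, L[j]? = M[j]?) ∧ L[i]? ≠ M[i]? ∧
      ∃ a b c : Pt, L[i - 1]? = some a ∧ L[i]? = some b ∧ M[i]? = some c ∧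
        det2 (b - a) (c - a) < 0

/-- `C ⊆ P` is geodesically convex: for all `p, q ∈ C` the geodesic connecting them
stays inside `C`. -/
def GeodesicallyConvex (P : SimplePolygon) (C : Set Pt) : Prop :=
  C ⊆ P.region ∧ ∀ p ∈ C, ∀ q ∈ C, ∀ L, P.IsGeodesicChain p q L → polylineSet L ⊆ C

/-- The geodesic hull `CH_P(U)`: the intersection of all geodesically convex subsets of `P`
containing `U`. -/
def geodesicHull (P : SimplePolygon) (U : Set Pt) : Set Pt :=
  ⋂₀ {C | GeodesicallyConvex P C ∧ U ⊆ C}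

/-- `E_P(S)`: the set of points of `S` lying on the (topological) boundary of the geodesic
hull of `S` with respect to `P`. -/
def extremeSet (P : SimplePolygon) (S : Set Pt) : Set Pt :=
  {x ∈ S | x ∈ frontier (geodesicHull P S)}

/-- `B` is separable from `R`: there is a simple polygon with at most `|B|` convex vertices
whose interior contains all points of `R` and which contains no point of `B`. -/
def Separable (B R : Finset Pt) : Prop :=
  ∃ P : SimplePolygon, P.CCW ∧ P.numConvex ≤ B.card ∧
    (∀ r ∈ R, r ∈ P.interior) ∧ ∀ b ∈ B, b ∉ P.region

/-- `R` ε-densely covers `B` (`d` being the minimum distance between two points of `B`):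
every closed convex wedge with apex `p ∈ B` — the intersection of the half-planes with
inward normals `u` and `v` through `p` — whose opening angle is greater than `ε`
(equivalently, the angle between `u` and `v` is less than `π − ε`) contains a point of `R`
at distance less than `d/2` from `p`. -/
def DenselyCovers (R B : Finset Pt) (d ε : ℝ) : Prop :=
  ∀ p ∈ B, ∀ u v : Pt, u ≠ 0 → v ≠ 0 →
    InnerProductGeometry.angle u v < Real.pi - ε →
    ∃ r ∈ R, 0 ≤ ⟪u, r - p⟫ ∧ 0 ≤ ⟪v, r - p⟫ ∧ dist r p < d / 2

/-- A point outside the interior of the convex hull of a set `s` admits a supporting half-space. -/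
theorem exists_inner_sub_nonpos_of_notMem_interior_convexHull {E : Type*}
    [NormedAddCommGroup E] [InnerProductSpace ℝ E] [FiniteDimensional ℝ E] {s : Set E} {p : E}
    (hps : p ∈ s) (hp : p ∉ interior (convexHull ℝ s)) :
    ∃ w : E, w ≠ 0 ∧ ∀ x ∈ s, ⟪w, x - p⟫ ≤ 0 := by
  by_cases hne : (interior (convexHull ℝ s)).Nonempty
  · obtain ⟨f, hf0, hf⟩ := geometric_hahn_banach_of_nonempty_interior_point
      (convex_convexHull ℝ s) hp hne
    refine ⟨(InnerProductSpace.toDual ℝ E).symm f, by simpa using hf0, fun x hx => ?_⟩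
    rw [InnerProductSpace.toDual_symm_apply, map_sub]
    exact sub_nonpos.2 (hf x (subset_convexHull ℝ s hx))
  · rw [interior_convexHull_nonempty_iff_affineSpan_eq_top] at hne
    have hp' : p ∈ affineSpan ℝ s := subset_affineSpan ℝ s hps
    have hdir : (affineSpan ℝ s).direction ≠ ⊤ := fun h =>
      hne ((AffineSubspace.direction_eq_top_iff_of_nonempty ⟨p, hp'⟩).1 h)
    have hort : (affineSpan ℝ s).directionᗮ ≠ ⊥ := fun h =>
      hdir (Submodule.orthogonal_eq_bot_iff.1 h)
    obtain ⟨w, hw, hw0⟩ := Submodule.exists_mem_ne_zero_of_ne_bot hort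
    refine ⟨w, hw0, fun x hx => le_of_eq ?_⟩
    exact Submodule.inner_left_of_mem_orthogonal
      (AffineSubspace.vsub_mem_direction (subset_affineSpan ℝ s hx) hp') hw

/-- Tilting a nonzero vector `w` slightly by `±t` yields two nonzero vectors at a small angle. -/
theorem exists_pos_angle_add_smul_sub_smul_lt {E : Type*}
    [NormedAddCommGroup E] [InnerProductSpace ℝ E] {w : E} (hw : w ≠ 0) (t : E) {θ : ℝ}
    (hθ : 0 < θ) :
    ∃ δ : ℝ, 0 < δ ∧ w + δ • t ≠ 0 ∧ w - δ • t ≠ 0 ∧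
      InnerProductGeometry.angle (w + δ • t) (w - δ • t) < θ := by
  have hadd : Filter.Tendsto (fun δ : ℝ => w + δ • t) (nhds 0) (nhds w) := by
    have h : Continuous fun δ : ℝ => w + δ • t := by fun_prop
    simpa using h.tendsto 0
  have hsub : Filter.Tendsto (fun δ : ℝ => w - δ • t) (nhds 0) (nhds w) := by
    have h : Continuous fun δ : ℝ => w - δ • t := by fun_prop
    simpa using h.tendsto 0
  have hang : Filter.Tendsto
      (fun δ : ℝ => InnerProductGeometry.angle (w + δ • t) (w - δ • t)) (nhds 0) (nhds 0) := by
    have h := (InnerProductGeometry.continuousAt_angle (x := (w, w)) hw hw).tendsto.comp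
      (hadd.prodMk_nhds hsub)
    simpa [Function.comp_def, InnerProductGeometry.angle_self hw] using h
  have hev := ((hadd.eventually_ne hw).and
    ((hsub.eventually_ne hw).and (hang.eventually_lt_const hθ))).filter_mono
    (nhdsWithin_le_nhds (s := Set.Ioi 0))
  obtain ⟨δ, ⟨h1, h2, h3⟩, hδ⟩ := (hev.and self_mem_nhdsWithin).exists
  exact ⟨δ, hδ, h1, h2, h3⟩

/-- A planar vector orthogonal to a nonzero `w` and to its quarter turn vanishes. -/
theorem eq_zero_of_inner_eq_zero_of_inner_rotate_eq_zero {w x : Pt} (hw : w ≠ 0)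
    (h₁ : ⟪w, x⟫ = 0) (h₂ : ⟪(!₂[-w 1, w 0] : Pt), x⟫ = 0) : x = 0 := by
  simp only [PiLp.inner_apply, Fin.sum_univ_two, RCLike.inner_apply, conj_trivial] at h₁ h₂
  simp only [Matrix.cons_val_zero, Matrix.cons_val_one] at h₂
  have hpos : w 0 ^ 2 + w 1 ^ 2 ≠ 0 := by
    intro h
    apply hw
    ext i
    fin_cases i
    · exact (pow_eq_zero_iff two_ne_zero).1 (show w 0 ^ 2 = 0 by
        linarith [sq_nonneg (w 0), sq_nonneg (w 1)])
    · exact (pow_eq_zero_iff two_ne_zero).1 (show w 1 ^ 2 = 0 by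
        linarith [sq_nonneg (w 0), sq_nonneg (w 1)])
  ext i
  fin_cases i
  · exact (mul_eq_zero.1 (show (w 0 ^ 2 + w 1 ^ 2) * x 0 = 0 by
      linear_combination w 0 * h₁ - w 1 * h₂)).resolve_left hpos
  · exact (mul_eq_zero.1 (show (w 0 ^ 2 + w 1 ^ 2) * x 1 = 0 by
      linear_combination w 1 * h₁ + w 0 * h₂)).resolve_left hpos

/-- If `R` ε-densely covers `B` (for `0 < ε < π`), then every point of `B`
lies in the topological interior of the convex hull of `B ∪ R`. -/
theorem dense_cover_no_blue_on_hull_boundary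
    (B R : Finset Pt) (hdisj : Disjoint B R) (hB : 2 ≤ B.card)
    (d : ℝ) (hd : IsLeast {r : ℝ | ∃ p ∈ B, ∃ q ∈ B, p ≠ q ∧ r = dist p q} d)
    (ε : ℝ) (hε0 : 0 < ε) (hεπ : ε < Real.pi)
    (hdense : DenselyCovers R B d ε) :
    ∀ p ∈ B, p ∈ interior (convexHull ℝ ((↑B ∪ ↑R : Set Pt))) := by
  intro p hp
  by_contra hint
  obtain ⟨w, hw, hsupp⟩ := exists_inner_sub_nonpos_of_notMem_interior_convexHull
    (Set.mem_union_left _ (Finset.mem_coe.2 hp)) hint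
  obtain ⟨δ, hδ, hu, hv, hang⟩ :=
    exists_pos_angle_add_smul_sub_smul_lt hw (!₂[-w 1, w 0] : Pt) (sub_pos.2 hεπ)
  obtain ⟨r, hr, hur, hvr, -⟩ := hdense p hp _ _ hu hv hang
  have hwr := hsupp r (Set.mem_union_right _ (Finset.mem_coe.2 hr))
  rw [inner_add_left, real_inner_smul_left] at hur
  rw [inner_sub_left, real_inner_smul_left] at hvr
  have hw0 : ⟪w, r - p⟫ = 0 := by linarith
  have ht0 : ⟪(!₂[-w 1, w 0] : Pt), r - p⟫ = 0 :=
    (mul_eq_zero.1 (by linarith :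
      δ * ⟪(!₂[-w 1, w 0] : Pt), r - p⟫ = 0)).resolve_left hδ.ne'
  have hrp : r = p :=
    sub_eq_zero.1 (eq_zero_of_inner_eq_zero_of_inner_rotate_eq_zero hw hw0 ht0)
  exact Finset.disjoint_left.1 hdisj hp (hrp ▸ hr)
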